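/- Let G be a finite connected distance-hereditary graph and let D(G) = {v : e(v) = diam(G)} be the set of all diametral vertices. Then D(G) is a radius certificate: for every vertex u of G, max_{x ∈ D(G)} d(u,x) ≥ rad(G). -/

import Mathlib

/-- A graph is distance-hereditary if every connected induced subgraph is isometric
(equivalently, every induced path is a shortest path). -/
def DistHereditary {V : Type*} (G : SimpleGraph V) : Prop :=
  ∀ s : Set V, (G.induce s).Connected →
    ∀ u v : s, (G.induce s).dist u v = G.dist (u : V) (v : V)

/-- Eccentricity of a vertex: `e(v) = max_{u} d(v,u)`. -/
noncomputable def ecc {V : Type*} [Fintype V] (G : SimpleGraph V) (v : V) : ℕ :=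
  Finset.univ.sup (fun u => G.dist v u)

/-- Radius: minimum eccentricity. -/
noncomputable def rad {V : Type*} [Fintype V] (G : SimpleGraph V) : ℕ :=
  sInf (Set.range (ecc G))

/-- Diameter: maximum eccentricity. -/
noncomputable def diam {V : Type*} [Fintype V] (G : SimpleGraph V) : ℕ :=
  Finset.univ.sup (fun v => ecc G v)

/-- The center: vertices of minimum eccentricity. -/
def center {V : Type*} [Fintype V] (G : SimpleGraph V) : Set V :=
  {v | ecc G v = rad G}

/-- Distance from a vertex to a set of vertices: `d(v,S) = min_{s ∈ S} d(v,s)`. -/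
noncomputable def distToSet {V : Type*} (G : SimpleGraph V) (v : V) (S : Set V) : ℕ :=
  sInf ((G.dist v) '' S)

/-- The interval `I(x,y)`: vertices on shortest `(x,y)`-paths. -/
def interval {V : Type*} (G : SimpleGraph V) (x y : V) : Set V :=
  {v | G.dist x v + G.dist v y = G.dist x y}

/-- The intervalSlice `S_k(x,y) = {v ∈ I(x,y) : d(x,v) = k}`. -/
def intervalSlice {V : Type*} (G : SimpleGraph V) (x y : V) (k : ℕ) : Set V :=
  {v | v ∈ interval G x y ∧ G.dist x v = k}

/-- The set `S` induces a cograph in `G`: no induced path on four vertices within `S`. -/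
def IsCographOn {V : Type*} (G : SimpleGraph V) (S : Set V) : Prop :=
  ¬ ∃ a b c d : V, a ∈ S ∧ b ∈ S ∧ c ∈ S ∧ d ∈ S ∧
    a ≠ c ∧ a ≠ d ∧ b ≠ d ∧
    G.Adj a b ∧ G.Adj b c ∧ G.Adj c d ∧ ¬ G.Adj a c ∧ ¬ G.Adj a d ∧ ¬ G.Adj b d

open SimpleGraph (Walk)

section Walks

variable {V : Type*} {G : SimpleGraph V} {a b m q t u v w x y z : V} {j k : ℕ}

/-- Every vertex of a shortest walk lies in the interval between the ends. -/
lemma dist_add_dist_of_mem_support (hconn : G.Connected) (p : G.Walk a b)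
    (hp : p.length = G.dist a b) (ht : t ∈ p.support) :
    G.dist a t + G.dist t b = G.dist a b := by
  obtain ⟨q, r, rfl⟩ := Walk.mem_support_iff_exists_append.mp ht
  have h₁ := SimpleGraph.dist_le q
  have h₂ := SimpleGraph.dist_le r
  have h₃ := hconn.dist_triangle (u := a) (v := t) (w := b)
  rw [Walk.length_append] at hp
  lia

/-- Along a walk, the distance to a fixed vertex attains all intermediate values. -/
lemma exists_mem_support_dist_eq (z : V) (p : G.Walk a b)
    (ha : G.dist z a ≤ k) (hb : k ≤ G.dist z b) : ∃ t ∈ p.support, G.dist z t = k := by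
  induction p with
  | nil => exact ⟨_, by simp, le_antisymm ha hb⟩
  | @cons a c b h p ih =>
    by_cases hc : G.dist z c ≤ k
    · obtain ⟨t, ht, htk⟩ := ih hc hb
      exact ⟨t, by simp [ht], htk⟩
    · refine ⟨a, by simp, ?_⟩
      rcases h.diff_dist_adj (u := z) with h | h | h <;> lia

/-- Intervals contain vertices at every intermediate distance. -/
lemma exists_dist_eq_of_le (hconn : G.Connected) (hk : k ≤ G.dist a b) :
    ∃ t, G.dist a t = k ∧ G.dist a t + G.dist t b = G.dist a b := by
  obtain ⟨p, hp⟩ := hconn.exists_walk_length_eq_dist a b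
  obtain ⟨t, ht, htk⟩ := exists_mem_support_dist_eq a p (by simp) hk
  exact ⟨t, htk, dist_add_dist_of_mem_support hconn p hp ht⟩

/-- `v` and `w` are joined by a walk that stays at distance at least `j` from `z`. -/
def JoinedAbove (G : SimpleGraph V) (z : V) (j : ℕ) (v w : V) : Prop :=
  ∃ p : G.Walk v w, ∀ t ∈ p.support, j ≤ G.dist z t

lemma JoinedAbove.symm (h : JoinedAbove G z j v w) : JoinedAbove G z j w v := by
  obtain ⟨p, hp⟩ := h
  exact ⟨p.reverse, by simpa using hp⟩

lemma JoinedAbove.trans (h : JoinedAbove G z j u v) (h' : JoinedAbove G z j v w) :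
    JoinedAbove G z j u w := by
  obtain ⟨p, hp⟩ := h
  obtain ⟨q, hq⟩ := h'
  refine ⟨p.append q, fun t ht => ?_⟩
  rcases (Walk.mem_support_append_iff _ _).mp ht with ht | ht
  · exact hp t ht
  · exact hq t ht

/-- If `v` and `w` are joined above the level of `q` and `q` lies between `z` and `v`,
then `q` lies between `z` and `w`. -/
lemma JoinedAbove.dist_add_dist (hconn : G.Connected) (hdh : DistHereditary G)
    (h : JoinedAbove G z (G.dist z q + 1) v w)
    (hq : G.dist z q + G.dist q v = G.dist z v) :
    G.dist z q + G.dist q w = G.dist z w := by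
  obtain ⟨p, hp⟩ := h
  obtain ⟨p₁, hp₁⟩ := hconn.exists_walk_length_eq_dist z q
  obtain ⟨p₂, hp₂⟩ := hconn.exists_walk_length_eq_dist q v
  have hlevel : ∀ t ∈ ((p₁.append p₂).append p).support, G.dist z t = G.dist z q → t = q := by
    intro t ht htq
    rw [Walk.mem_support_append_iff, Walk.mem_support_append_iff] at ht
    rcases ht with (ht | ht) | ht
    · have := dist_add_dist_of_mem_support hconn p₁ hp₁ ht
      exact hconn.dist_eq_zero_iff.mp (by lia)
    · have h₁ := dist_add_dist_of_mem_support hconn p₂ hp₂ ht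
      have h₂ := hconn.dist_triangle (u := z) (v := t) (w := v)
      exact (hconn.dist_eq_zero_iff.mp (by lia)).symm
    · have := hp t ht
      lia
  have hS := ((p₁.append p₂).append p).connected_induce_support
  have hz : z ∈ ((p₁.append p₂).append p).support := Walk.start_mem_support _
  have hw : w ∈ ((p₁.append p₂).append p).support := Walk.end_mem_support _
  obtain ⟨r, hr⟩ := hS.exists_walk_length_eq_dist ⟨z, hz⟩ ⟨w, hw⟩
  rw [hdh _ hS] at hr
  let r' : G.Walk z w := r.map (SimpleGraph.Embedding.induce _).toHom
  have hr' : r'.length = G.dist z w := by rw [← hr]; exact Walk.length_map _ _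
  obtain ⟨t, ht, htq⟩ := exists_mem_support_dist_eq z r' (k := G.dist z q) (by simp)
    (by have := hp w p.end_mem_support; lia)
  have htS : t ∈ ((p₁.append p₂).append p).support := by
    have ht' : t ∈ r.support.map (SimpleGraph.Embedding.induce (G := G) _).toHom := by
      rw [← Walk.support_map]; exact ht
    obtain ⟨s, -, rfl⟩ := List.mem_map.mp ht'
    exact s.2
  obtain rfl := hlevel t htS htq
  exact dist_add_dist_of_mem_support hconn r' hr' ht

lemma JoinedAbove.dist_le (hconn : G.Connected) (hdh : DistHereditary G)
    (h : JoinedAbove G z (j + 1) v w) : G.dist v w + 2 * j ≤ G.dist z v + G.dist z w := by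
  have hv : j + 1 ≤ G.dist z v := by
    obtain ⟨p, hp⟩ := h
    exact hp v p.start_mem_support
  obtain ⟨q, rfl, hq⟩ := exists_dist_eq_of_le hconn (a := z) (b := v) (k := j) (by lia)
  have h₁ := h.dist_add_dist hconn hdh hq
  have h₂ := hconn.dist_triangle (u := v) (v := q) (w := w)
  have h₃ := G.dist_comm (u := v) (v := q)
  lia

lemma joinedAbove_of_lt (hconn : G.Connected)
    (h : G.dist v w + 2 * j < G.dist z v + G.dist z w + 2) : JoinedAbove G z j v w := by
  obtain ⟨p, hp⟩ := hconn.exists_walk_length_eq_dist v w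
  refine ⟨p, fun t ht => ?_⟩
  have h₁ := dist_add_dist_of_mem_support hconn p hp ht
  have h₂ := hconn.dist_triangle (u := z) (v := t) (w := v)
  have h₃ := hconn.dist_triangle (u := z) (v := t) (w := w)
  have h₄ := G.dist_comm (u := v) (v := t)
  lia

/-- A walk starting above level `j` and not staying there has a first vertex at level `j`. -/
lemma exists_first_below (hx : j + 1 ≤ G.dist z x) (p : G.Walk x y)
    (h : ¬ JoinedAbove G z (j + 1) x y) :
    ∃ q ∈ p.support, ∃ s, G.Adj q s ∧ G.dist z q = j ∧ JoinedAbove G z (j + 1) x s := by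
  induction p with
  | nil => exact absurd ⟨Walk.nil, by simpa using hx⟩ h
  | @cons x c y hadj p ih =>
    by_cases hc : j + 1 ≤ G.dist z c
    · have hxc : JoinedAbove G z (j + 1) x c := ⟨hadj.toWalk, by
        simpa using ⟨hx, hc⟩⟩
      obtain ⟨q, hq, s, hqs, hqj, hcs⟩ := ih hc fun hcy => h (hxc.trans hcy)
      exact ⟨q, by simp [hq], s, hqs, hqj, hxc.trans hcs⟩
    · refine ⟨c, by simp, x, hadj.symm, ?_, Walk.nil, by simpa using hx⟩
      rcases hadj.diff_dist_adj (u := z) with h | h | h <;> lia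

lemma dist_add_dist_le_of_joinedAbove (hconn : G.Connected) (hdh : DistHereditary G)
    (h : JoinedAbove G z (j + 1) x u) (hxy : ¬ JoinedAbove G z (j + 1) x y) :
    G.dist u y + G.dist z x ≤ G.dist x y + G.dist z u := by
  have hx : j + 1 ≤ G.dist z x := by
    obtain ⟨p, hp⟩ := h
    exact hp x p.start_mem_support
  obtain ⟨p, hp⟩ := hconn.exists_walk_length_eq_dist x y
  obtain ⟨q, hq, s, hqs, rfl, hxs⟩ := exists_first_below hx p hxy
  have hs : G.dist z q + 1 ≤ G.dist z s := by
    obtain ⟨p, hp⟩ := hxs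
    exact hp s p.end_mem_support
  have hqs' : G.dist q s = 1 := SimpleGraph.dist_eq_one_iff_adj.mpr hqs
  have h₀ := hconn.dist_triangle (u := z) (v := q) (w := s)
  have h₁ := hxs.symm.dist_add_dist hconn hdh (by lia)
  have h₂ := h.dist_add_dist hconn hdh h₁
  have h₃ := dist_add_dist_of_mem_support hconn p hp hq
  have h₄ := hconn.dist_triangle (u := u) (v := q) (w := y)
  have h₅ := G.dist_comm (u := u) (v := q)
  have h₆ := G.dist_comm (u := x) (v := q)
  lia

/-- A four-point inequality of distance-hereditary graphs: if one of the three distance sums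
exceeds another one, then it exceeds the third by at most two. -/
lemma DistHereditary.four_point (hconn : G.Connected) (hdh : DistHereditary G)
    (h : G.dist u y + G.dist z x < G.dist x y + G.dist z u) :
    G.dist x y + G.dist z u ≤ G.dist u x + G.dist z y + 2 := by
  classical
  by_contra! hlt
  have hex : ∃ j, ¬ JoinedAbove G z (j + 1) x y := by
    refine ⟨G.dist z x, fun ⟨p, hp⟩ => ?_⟩
    have := hp x p.start_mem_support
    lia
  have hj := Nat.find_spec hex
  have hmin := fun i => Nat.find_min hex (m := i)
  generalize Nat.find hex = j at hj hmin
  have hbound : G.dist x y + 2 * j ≤ G.dist z x + G.dist z y + 2 := by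
    rcases j with _ | i
    · have h₁ := hconn.dist_triangle (u := x) (v := z) (w := y)
      have h₂ := G.dist_comm (u := x) (v := z)
      lia
    · have := (not_not.mp (hmin i (by lia))).dist_le hconn hdh
      lia
  have hux : JoinedAbove G z (j + 1) u x := joinedAbove_of_lt hconn (by lia)
  have := dist_add_dist_le_of_joinedAbove hconn hdh hux fun huy => hj (hux.symm.trans huy)
  lia

/-- If `m` lies between `z` and `u` at distance two from `u`, and `w` is far enough from `z`,
then `m` lies between `z` and `w`. -/
lemma dist_add_dist_of_two_below (hconn : G.Connected) (hdh : DistHereditary G)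
    (hm : G.dist z m + 2 = G.dist z u) (hmu : G.dist m u = 2)
    (hw : G.dist u w + G.dist z u ≤ G.dist z w + 3) :
    G.dist z m + G.dist m w = G.dist z w :=
  JoinedAbove.dist_add_dist (v := u) hconn hdh (joinedAbove_of_lt hconn (by lia)) (by lia)

end Walks

section Finite

variable {V : Type*} [Fintype V] {G : SimpleGraph V}

lemma dist_le_ecc (u v : V) : G.dist u v ≤ ecc G u :=
  Finset.le_sup (f := fun v => G.dist u v) (Finset.mem_univ v)

lemma ecc_le_diam (u : V) : ecc G u ≤ diam G :=
  Finset.le_sup (f := fun v => ecc G v) (Finset.mem_univ u)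

lemma rad_le_ecc (u : V) : rad G ≤ ecc G u := Nat.sInf_le ⟨u, rfl⟩

lemma exists_dist_eq_ecc (u : V) : ∃ v, G.dist u v = ecc G u := by
  obtain ⟨v, -, hv⟩ := Finset.exists_mem_eq_sup Finset.univ ⟨u, Finset.mem_univ u⟩
    (fun v => G.dist u v)
  exact ⟨v, hv.symm⟩

lemma exists_ecc_eq_diam [Nonempty V] (G : SimpleGraph V) : ∃ v, ecc G v = diam G := by
  obtain ⟨v, -, hv⟩ := Finset.exists_mem_eq_sup Finset.univ Finset.univ_nonempty
    (fun v => ecc G v)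
  exact ⟨v, hv.symm⟩

lemma dist_le_diam (u v : V) : G.dist u v ≤ diam G := (dist_le_ecc u v).trans (ecc_le_diam u)

lemma ecc_eq_diam_of_dist_eq {u v : V} (h : G.dist u v = diam G) : ecc G u = diam G :=
  le_antisymm (ecc_le_diam u) (h ▸ dist_le_ecc u v)

/-- A descent principle: the vertices within distance `a` of all of `W` cannot all have
`r`-far vertices of the prescribed shape, when no two such far vertices are at distance
`2 * r - 2` or more. -/
lemma false_of_far_vertices (hconn : G.Connected) (hdh : DistHereditary G) {W : Set V}
    {a r : ℕ} (hr : 2 ≤ r) (hrad : r ≤ rad G)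
    (hfar : ∀ u z, (∀ w ∈ W, G.dist u w ≤ a) → r ≤ G.dist u z → G.dist u z = r ∧
      ∀ w ∈ W, G.dist z w + 2 ≤ a + r ∧ G.dist u w + r ≤ G.dist z w + 3)
    (hpair : ∀ u u' z z', (∀ w ∈ W, G.dist u w ≤ a) → (∀ w ∈ W, G.dist u' w ≤ a) →
      r ≤ G.dist u z → r ≤ G.dist u' z' → G.dist z z' + 3 ≤ 2 * r)
    {u₀ : V} (hu₀ : ∀ w ∈ W, G.dist u₀ w ≤ a) : False := by
  classical
  let F : V → Finset V := fun u => Finset.univ.filter fun z => r ≤ G.dist u z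
  have hF : ∀ u z, z ∈ F u ↔ r ≤ G.dist u z := fun u z => by simp [F]
  obtain ⟨u, hu, hmin⟩ := Set.exists_min_image {u | ∀ w ∈ W, G.dist u w ≤ a}
    (fun u => (F u).card) (Set.toFinite _) ⟨u₀, hu₀⟩
  obtain ⟨z, hz⟩ := exists_dist_eq_ecc (G := G) u
  have huz : r ≤ G.dist u z := hz ▸ hrad.trans (rad_le_ecc u)
  obtain ⟨huz', hzW⟩ := hfar u z hu huz
  have hzu : G.dist z u = r := by rw [SimpleGraph.dist_comm, huz']
  obtain ⟨m, hzm, hm⟩ := exists_dist_eq_of_le hconn (a := z) (b := u) (k := r - 2) (by lia)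
  have hmW : ∀ w ∈ W, G.dist m w ≤ a := by
    intro w hw
    obtain ⟨h₁, h₂⟩ := hzW w hw
    have := dist_add_dist_of_two_below hconn hdh (z := z) (m := m) (u := u) (w := w)
      (by lia) (by lia) (by lia)
    lia
  have hmz : G.dist m z = r - 2 := by rw [SimpleGraph.dist_comm, hzm]
  obtain ⟨z', hz', hz'u⟩ : ∃ z' ∈ F m, z' ∉ F u := by
    by_contra! hsub
    have hlt : (F m).card < (F u).card :=
      Finset.card_lt_card ⟨hsub, fun h => by
        have := (hF m z).mp (h ((hF u z).mpr huz))
        lia⟩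
    exact absurd (hmin m hmW) (by simpa using hlt)
  rw [hF] at hz' hz'u
  have hmz' := (hfar m z' hmW hz').1
  have hzz' := hpair u m z z' hu hmW huz hz'
  have h₁ := G.dist_comm (u := z') (v := m)
  have h₂ := G.dist_comm (u := z') (v := u)
  have h₃ := hdh.four_point hconn (x := z) (y := u) (z := z') (u := m)
  have h₄ := G.dist_comm (u := z') (v := z)
  lia

/-- In a distance-hereditary graph the diameter is at least `2 * rad - 2`. -/
lemma two_mul_rad_le_diam_add_two (hconn : G.Connected) (hdh : DistHereditary G) :
    2 * rad G ≤ diam G + 2 := by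
  have := hconn.nonempty
  by_contra! hlt
  obtain ⟨x, hx⟩ := exists_ecc_eq_diam G
  obtain ⟨y, hy⟩ := exists_dist_eq_ecc (G := G) x
  rw [hx] at hy
  obtain ⟨u₀, hu₀, hu₀'⟩ := exists_dist_eq_of_le hconn (a := x) (b := y)
    (k := (diam G + 1) / 2) (by lia)
  have key : ∀ u z, G.dist u x ≤ (diam G + 1) / 2 → G.dist u y ≤ (diam G + 1) / 2 →
      rad G ≤ G.dist u z → G.dist u z = rad G ∧
      (G.dist z x + 2 ≤ (diam G + 1) / 2 + rad G ∧ G.dist u x + rad G ≤ G.dist z x + 3) ∧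
      (G.dist z y + 2 ≤ (diam G + 1) / 2 + rad G ∧ G.dist u y + rad G ≤ G.dist z y + 3) := by
    intro u z hux huy huz
    have h₁ := hdh.four_point hconn (x := x) (y := y) (z := z) (u := u)
    have h₂ := hdh.four_point hconn (x := y) (y := x) (z := z) (u := u)
    have h₃ := G.dist_comm (u := x) (v := y)
    have h₄ := G.dist_comm (u := u) (v := z)
    have h₅ := dist_le_diam (G := G) z x
    have h₆ := dist_le_diam (G := G) z y
    have h₇ : G.dist z u = rad G ∨
        G.dist z u = (diam G + 1) / 2 + 2 ∧ diam G + 1 = 2 * ((diam G + 1) / 2) := by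
      lia
    rcases h₇ with h₇ | ⟨h₇, h₈⟩
    · lia
    · obtain ⟨m, hzm, hm⟩ := exists_dist_eq_of_le hconn (a := z) (b := u)
        (k := (diam G + 1) / 2) (by lia)
      have h₉ := dist_add_dist_of_two_below hconn hdh (z := z) (m := m) (u := u) (w := x)
        (by lia) (by lia) (by lia)
      have h₁₀ := dist_add_dist_of_two_below hconn hdh (z := z) (m := m) (u := u) (w := y)
        (by lia) (by lia) (by lia)
      have h₁₁ := hconn.dist_triangle (u := x) (v := m) (w := y)
      have h₁₂ := G.dist_comm (u := x) (v := m)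
      lia
  refine false_of_far_vertices hconn hdh (W := {x, y}) (a := (diam G + 1) / 2) (r := rad G)
    (by lia) le_rfl ?_ ?_ (u₀ := u₀) ?_
  · intro u z hu huz
    obtain ⟨h₁, h₂, h₃⟩ := key u z (hu x (by simp)) (hu y (by simp)) huz
    refine ⟨h₁, ?_⟩
    rintro w (rfl | rfl)
    · exact h₂
    · exact h₃
  · intro u u' z z' _ _ _ _
    have := dist_le_diam (G := G) z z'
    lia
  · rintro w (rfl | rfl)
    · rw [SimpleGraph.dist_comm]; lia
    · lia

end Finite

/-- In a finite connected distance-hereditary graph, the set of diametral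
vertices is a radius certificate: for every vertex `u` there is a diametral vertex `x`
with `d(u,x) ≥ rad(G)`. -/
theorem diametral_set_is_radius_certificate {V : Type*} [Fintype V] (G : SimpleGraph V)
    (hconn : G.Connected) (hdh : DistHereditary G) :
    ∀ u : V, ∃ x : V, ecc G x = diam G ∧ rad G ≤ G.dist u x := by
  intro u₀
  by_contra! hu₀
  have := hconn.nonempty
  have hdiam := two_mul_rad_le_diam_add_two hconn hdh
  have hpartner : ∀ x, ecc G x = diam G → ∃ y, ecc G y = diam G ∧ G.dist x y = diam G := by
    intro x hx
    obtain ⟨y, hy⟩ := exists_dist_eq_ecc (G := G) x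
    rw [hx] at hy
    exact ⟨y, ecc_eq_diam_of_dist_eq (by rw [SimpleGraph.dist_comm, hy]), hy⟩
  obtain ⟨x, hx⟩ := exists_ecc_eq_diam G
  obtain ⟨y, hy, hxy⟩ := hpartner x hx
  have hdiam' : diam G + 2 = 2 * rad G := by
    have h₁ := hu₀ x hx
    have h₂ := hu₀ y hy
    have h₃ := hconn.dist_triangle (u := x) (v := u₀) (w := y)
    have h₄ := G.dist_comm (u := x) (v := u₀)
    lia
  have hrad : rad G ≤ diam G := (rad_le_ecc x).trans (ecc_le_diam x)
  have hnot : ∀ u z, (∀ w ∈ {w | ecc G w = diam G}, G.dist u w ≤ rad G - 1) →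
      rad G ≤ G.dist u z → ∀ t, G.dist z t + 1 ≤ diam G := by
    intro u z hu huz t
    by_contra! hlt
    have := hu z (ecc_eq_diam_of_dist_eq (le_antisymm (dist_le_diam z t) (by lia)))
    lia
  refine false_of_far_vertices hconn hdh (W := {w | ecc G w = diam G}) (a := rad G - 1)
    (r := rad G) (by lia) le_rfl ?_ ?_ (u₀ := u₀) fun w hw => Nat.le_sub_one_of_lt (hu₀ w hw)
  · intro u z hu huz
    have key : ∀ w, ecc G w = diam G → G.dist u z = rad G ∧
        G.dist z w + 2 ≤ rad G - 1 + rad G ∧ G.dist u w + rad G ≤ G.dist z w + 3 := by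
      intro w hw
      obtain ⟨w', hw', hww'⟩ := hpartner w hw
      have h₁ := hdh.four_point hconn (x := w) (y := w') (z := z) (u := u)
      have h₂ := hdh.four_point hconn (x := w') (y := w) (z := z) (u := u)
      have h₃ := G.dist_comm (u := w) (v := w')
      have h₄ := G.dist_comm (u := u) (v := z)
      have h₅ := hnot u z hu huz w
      have h₆ := hnot u z hu huz w'
      have h₇ := hu w hw
      have h₈ := hu w' hw'
      lia
    exact ⟨(key x hx).1, fun w hw => (key w hw).2⟩
  · intro u u' z z' hu _ huz _
    have := hnot u z hu huz z'
    lia
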